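/- arXiv:math/0510586 — 2 statements merged into one kernel-verified Lean document; each statement's English description precedes it below -/
import Mathlib

section
/- Let X₁,…,X_n be real random variables with E[X_v] = 0 for all v, let S_v ⊆ {1,…,n} for each v, set W = Σ_{v=1}^n X_v, and suppose σ² := Σ_{v=1}^n Σ_{u∈S_v} E[X_v X_u] > 0. Then for every bounded, continuous, piecewise continuously differentiable h : ℝ → ℝ with bounded derivative, |E[h(W/σ)] − E[h(Z)]| ≤ (2‖h‖/σ²)·√(E[(Σ_{v=1}^n Σ_{u∈S_v} (X_v X_u − E[X_v X_u]))²]) + √(π/2)·(‖h‖/σ)·Σ_{v=1}^n E[|E[X_v | X_u : u ∉ S_v]|] + (‖h′‖/σ³)·Σ_{v=1}^n E[|X_v · (Σ_{u∈S_v} X_u) · (Σ_{t∈S_v} X_t)|], where Z is a standard normal random variable and ‖·‖ is the supremum norm. -/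
open MeasureTheory ProbabilityTheory Real

/-- `PiecewiseC1 h` : `h` is piecewise continuously differentiable. -/
def PiecewiseC1 (h : ℝ → ℝ) : Prop :=
  ∃ S : Finset ℝ, ∀ x ∉ (S : Set ℝ), DifferentiableAt ℝ h x ∧ ContinuousAt (deriv h) x

open Filter Topology

namespace SteinNormal

/-- The unnormalized standard Gaussian density. -/
noncomputable def gaussKernel (x : ℝ) : ℝ := exp (-x ^ 2 / 2)

lemma gaussKernel_pos (x : ℝ) : 0 < gaussKernel x := exp_pos _

lemma gaussKernel_neg (x : ℝ) : gaussKernel (-x) = gaussKernel x := by simp [gaussKernel]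

lemma exp_mul_gaussKernel (x : ℝ) : exp (x ^ 2 / 2) * gaussKernel x = 1 := by
  rw [gaussKernel, ← exp_add, neg_div, add_neg_cancel, exp_zero]

lemma gaussKernel_eq : gaussKernel = fun x => exp (-(1 / 2) * x ^ 2) := by
  ext x
  rw [gaussKernel]
  ring_nf

lemma continuous_gaussKernel : Continuous gaussKernel := by
  unfold gaussKernel
  fun_prop

lemma integrable_gaussKernel : Integrable gaussKernel := by
  rw [gaussKernel_eq]
  exact integrable_exp_neg_mul_sq (by norm_num)

lemma integrable_id_mul_gaussKernel : Integrable (fun x => x * gaussKernel x) := by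
  rw [gaussKernel_eq]
  exact integrable_mul_exp_neg_mul_sq (by norm_num)

lemma integral_gaussKernel : ∫ x, gaussKernel x = √(2 * π) := by
  rw [gaussKernel_eq, integral_gaussian]
  congr 1
  ring

lemma integral_Ioi_zero_gaussKernel : ∫ x in Set.Ioi 0, gaussKernel x = √(2 * π) / 2 := by
  rw [gaussKernel_eq, integral_gaussian_Ioi]
  congr 2
  ring

lemma hasDerivAt_gaussKernel (x : ℝ) : HasDerivAt gaussKernel (-x * gaussKernel x) x := by
  have h1 : HasDerivAt (fun y : ℝ => -y ^ 2 / 2) (-x) x := by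
    have := ((hasDerivAt_pow 2 x).neg).div_const 2
    convert! this using 1
    simp only [Nat.cast_ofNat, Nat.add_one_sub_one, pow_one]
    ring
  convert! h1.exp using 1
  rw [gaussKernel, mul_comm]

lemma tendsto_gaussKernel_atTop : Tendsto gaussKernel atTop (𝓝 0) := by
  have : Tendsto (fun x : ℝ => x ^ 2 / 2) atTop atTop :=
    (tendsto_pow_atTop two_ne_zero).atTop_div_const two_pos
  refine (tendsto_exp_neg_atTop_nhds_zero.comp this).congr fun x => ?_
  simp [gaussKernel, neg_div]

lemma tendsto_gaussKernel_atBot : Tendsto gaussKernel atBot (𝓝 0) :=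
  (tendsto_gaussKernel_atTop.comp tendsto_neg_atBot_atTop).congr gaussKernel_neg

lemma integral_Iic_gaussKernel (w : ℝ) :
    ∫ x in Set.Iic w, gaussKernel x = ∫ x in Set.Ioi (-w), gaussKernel x := by
  rw [← integral_comp_neg_Iic]
  simp only [gaussKernel_neg]

lemma integral_Iic_add_Ioi {g : ℝ → ℝ} (hg : Integrable g) (w : ℝ) :
    (∫ x in Set.Iic w, g x) + ∫ x in Set.Ioi w, g x = ∫ x, g x := by
  rw [← Set.compl_Iic]
  exact integral_add_compl measurableSet_Iic hg

lemma integral_Ioi_id_mul_gaussKernel (w : ℝ) :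
    ∫ x in Set.Ioi w, x * gaussKernel x = gaussKernel w := by
  have h := integral_Ioi_of_hasDerivAt_of_tendsto' (f := fun x => -gaussKernel x)
    (f' := fun x => x * gaussKernel x) (a := w) (m := 0)
    (fun x _ => by simpa using! (hasDerivAt_gaussKernel x).neg)
    integrable_id_mul_gaussKernel.integrableOn (by simpa using tendsto_gaussKernel_atTop.neg)
  simpa using h

lemma integral_id_mul_gaussKernel : ∫ x, x * gaussKernel x = 0 := by
  have h := integral_of_hasDerivAt_of_tendsto (f := fun x => -gaussKernel x)
    (f' := fun x => x * gaussKernel x) (m := 0) (n := 0)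
    (fun x => by simpa using! (hasDerivAt_gaussKernel x).neg)
    integrable_id_mul_gaussKernel (by simpa using tendsto_gaussKernel_atBot.neg)
    (by simpa using tendsto_gaussKernel_atTop.neg)
  simpa using h

lemma integral_Iic_id_mul_gaussKernel (w : ℝ) :
    ∫ x in Set.Iic w, x * gaussKernel x = -gaussKernel w := by
  have h := integral_Iic_add_Ioi integrable_id_mul_gaussKernel w
  rw [integral_Ioi_id_mul_gaussKernel, integral_id_mul_gaussKernel] at h
  linarith

/-- Upper Mills ratio bound. -/
lemma mul_integral_Ioi_gaussKernel_le (w : ℝ) :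
    w * ∫ x in Set.Ioi w, gaussKernel x ≤ gaussKernel w := by
  rw [← integral_Ioi_id_mul_gaussKernel w, ← integral_const_mul]
  refine setIntegral_mono_on (integrable_gaussKernel.const_mul w).integrableOn
    integrable_id_mul_gaussKernel.integrableOn measurableSet_Ioi fun x hx => ?_
  exact mul_le_mul_of_nonneg_right (le_of_lt hx) (gaussKernel_pos x).le

/-- Lower Mills ratio bound. -/
lemma mul_gaussKernel_le_integral_Ioi (w : ℝ) :
    w * gaussKernel w ≤ (1 + w ^ 2) * ∫ x in Set.Ioi w, gaussKernel x := by
  let d : ℝ → ℝ := fun x => (x ^ 4 + 2 * x ^ 2 - 1) / (1 + x ^ 2) ^ 2 * gaussKernel x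
  have hd : ∀ x : ℝ, |(x ^ 4 + 2 * x ^ 2 - 1) / (1 + x ^ 2) ^ 2| ≤ 1 := fun x => by
    have hp : 0 < (1 + x ^ 2) ^ 2 := by positivity
    rw [abs_le, le_div_iff₀ hp, div_le_iff₀ hp]
    constructor <;> nlinarith [sq_nonneg x, sq_nonneg (x ^ 2)]
  have hint : Integrable d := by
    refine integrable_gaussKernel.bdd_mul (c := 1) ?_ (ae_of_all _ hd)
    refine Continuous.aestronglyMeasurable ?_
    refine Continuous.div (by fun_prop) (by fun_prop) fun x => by positivity
  have hderiv : ∀ x, HasDerivAt (fun y : ℝ => -(y / (1 + y ^ 2)) * gaussKernel y) (d x) x := by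
    intro x
    have hp : (1 + x ^ 2) ≠ 0 := by positivity
    have h1 : HasDerivAt (fun y : ℝ => 1 + y ^ 2) (2 * x) x := by
      simpa using (hasDerivAt_pow 2 x).const_add 1
    have h2 := (((hasDerivAt_id x).div h1 hp).neg).mul (hasDerivAt_gaussKernel x)
    convert! h2 using 1
    simp only [d, id, Pi.neg_apply, Pi.div_apply]
    field_simp
    ring
  have htend : Tendsto (fun y : ℝ => -(y / (1 + y ^ 2)) * gaussKernel y) atTop (𝓝 0) := by
    refine squeeze_zero_norm (fun y => ?_) tendsto_gaussKernel_atTop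
    rw [norm_mul, norm_neg, Real.norm_eq_abs, Real.norm_eq_abs, abs_of_pos (gaussKernel_pos y)]
    refine mul_le_of_le_one_left (gaussKernel_pos y).le ?_
    have hp : 0 < 1 + y ^ 2 := by positivity
    rw [abs_le, le_div_iff₀ hp, div_le_iff₀ hp]
    constructor <;> nlinarith [sq_nonneg (y - 1), sq_nonneg (y + 1)]
  have h := integral_Ioi_of_hasDerivAt_of_tendsto' (a := w) (fun x _ => hderiv x)
    hint.integrableOn htend
  have hle : ∫ x in Set.Ioi w, d x ≤ ∫ x in Set.Ioi w, gaussKernel x :=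
    setIntegral_mono hint.integrableOn integrable_gaussKernel.integrableOn fun x =>
      mul_le_of_le_one_left (gaussKernel_pos x).le (le_of_abs_le (hd x))
  rw [h] at hle
  have hp : 0 < 1 + w ^ 2 := by positivity
  calc w * gaussKernel w = (1 + w ^ 2) * (0 - -(w / (1 + w ^ 2)) * gaussKernel w) := by
        field_simp
        ring
    _ ≤ _ := mul_le_mul_of_nonneg_left hle hp.le

lemma neg_mul_integral_Iic_gaussKernel_le (w : ℝ) :
    -w * ∫ x in Set.Iic w, gaussKernel x ≤ gaussKernel w := by
  rw [integral_Iic_gaussKernel]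
  simpa [gaussKernel_neg] using mul_integral_Ioi_gaussKernel_le (-w)

lemma neg_mul_gaussKernel_le_integral_Iic (w : ℝ) :
    -w * gaussKernel w ≤ (1 + w ^ 2) * ∫ x in Set.Iic w, gaussKernel x := by
  rw [integral_Iic_gaussKernel]
  simpa [gaussKernel_neg] using mul_gaussKernel_le_integral_Ioi (-w)

/-- The square of the Gaussian integral over `[0, w]` dominates the integral over the quarter disc
of radius `w`. -/
lemma one_sub_gaussKernel_le_sq (w : ℝ) (hw : 0 ≤ w) :
    π / 2 * (1 - gaussKernel w) ≤ (∫ x in (0 : ℝ)..w, gaussKernel x) ^ 2 := by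
  let t : ℝ → ℝ := fun w => ∫ x in (0 : ℝ)..w, gaussKernel x
  have ht : ∀ x, HasDerivAt t (gaussKernel x) x := fun x =>
    continuous_gaussKernel.integral_hasStrictDerivAt 0 x |>.hasDerivAt
  have ht0 : t 0 = 0 := intervalIntegral.integral_same
  let q : ℝ → ℝ := fun x => 2 * t x - π / 2 * x
  have hq : ∀ x, HasDerivAt q (2 * gaussKernel x - π / 2) x := fun x => by
    simpa using! ((ht x).const_mul 2).sub ((hasDerivAt_id x).const_mul (π / 2))
  let G : ℝ → ℝ := fun x => t x ^ 2 - π / 2 * (1 - gaussKernel x)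
  have hG : ∀ x, HasDerivAt G (gaussKernel x * q x) x := fun x => by
    have := ((ht x).pow 2).sub ((((hasDerivAt_gaussKernel x).const_sub 1)).const_mul (π / 2))
    convert! this using 1
    simp only [q]
    push_cast
    ring
  have hanti : AntitoneOn gaussKernel (Set.Ici 0) := fun x hx y hy hxy => by
    unfold gaussKernel
    have : x ^ 2 ≤ y ^ 2 := pow_le_pow_left₀ hx hxy 2
    exact exp_le_exp.2 (by linarith)
  have hconc : ConcaveOn ℝ (Set.Ici 0) q := by
    refine AntitoneOn.concaveOn_of_deriv (convex_Ici 0)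
      (fun x _ => (hq x).continuousAt.continuousWithinAt)
      (fun x _ => (hq x).differentiableAt.differentiableWithinAt) ?_
    intro x hx y hy hxy
    rw [(hq x).deriv, (hq y).deriv]
    have := hanti (interior_subset hx) (interior_subset hy) hxy
    linarith
  have hq0 : q 0 = 0 := by simp [q, ht0]
  have key : ∀ x y, 0 ≤ x → x ≤ y → 0 < y → x * q y ≤ y * q x := fun x y hx hxy hy => by
    have := hconc.2 (Set.mem_Ici.2 le_rfl) (Set.mem_Ici.2 hy.le) (sub_nonneg.2 ((div_le_one hy).2 hxy))
      (div_nonneg hx hy.le) (by ring)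
    simp only [smul_eq_mul, hq0, mul_zero, zero_add, div_mul_cancel₀ x hy.ne'] at this
    calc x * q y = y * (x / y * q y) := by field_simp
      _ ≤ _ := mul_le_mul_of_nonneg_left this hy.le
  suffices h : 0 ≤ G w by simpa [G, t, sub_nonneg] using h
  rcases hw.eq_or_lt with rfl | hw
  · simp [G, ht0, gaussKernel]
  rcases le_or_gt 0 (q w) with hqw | hqw
  · have hmono : MonotoneOn G (Set.Icc 0 w) := by
      refine monotoneOn_of_deriv_nonneg (convex_Icc 0 w)
        (fun x _ => (hG x).continuousAt.continuousWithinAt)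
        (fun x _ => (hG x).differentiableAt.differentiableWithinAt) fun x hx => ?_
      rw [(hG x).deriv]
      have hx' := interior_subset hx
      have := key x w hx'.1 hx'.2 hw
      have h2 : 0 ≤ w * q x := (mul_nonneg hx'.1 hqw).trans this
      exact mul_nonneg (gaussKernel_pos x).le (nonneg_of_mul_nonneg_right h2 hw)
    have := hmono (Set.left_mem_Icc.2 hw.le) (Set.right_mem_Icc.2 hw.le) hw.le
    simpa [G, ht0, gaussKernel] using this
  · have hant : AntitoneOn G (Set.Ici w) := by
      refine antitoneOn_of_deriv_nonpos (convex_Ici w)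
        (fun x _ => (hG x).continuousAt.continuousWithinAt)
        (fun x _ => (hG x).differentiableAt.differentiableWithinAt) fun x hx => ?_
      rw [(hG x).deriv]
      have hx' : w ≤ x := interior_subset hx
      have := key w x hw.le hx' (hw.trans_le hx')
      have h2 : w * q x ≤ 0 := this.trans
        (mul_nonpos_of_nonneg_of_nonpos (hw.le.trans hx') hqw.le)
      refine mul_nonpos_of_nonneg_of_nonpos (gaussKernel_pos x).le ?_
      by_contra! hcon
      exact absurd h2 (not_le.2 (mul_pos hw hcon))
    have hlim : Tendsto G atTop (𝓝 0) := by
      have h1 : Tendsto t atTop (𝓝 (√(2 * π) / 2)) := by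
        rw [← integral_Ioi_zero_gaussKernel]
        exact intervalIntegral_tendsto_integral_Ioi 0 integrable_gaussKernel.integrableOn
          tendsto_id
      have h2 := (h1.pow 2).sub ((tendsto_gaussKernel_atTop.const_sub 1).const_mul (π / 2))
      convert! h2 using 2
      rw [div_pow, sq_sqrt (by positivity)]
      ring
    refine le_of_tendsto hlim ?_
    filter_upwards [eventually_ge_atTop w] with x hx
    exact hant Set.self_mem_Ici hx hx

/-- The product of the two Gaussian tails at `w` is at most its value at `0` times the kernel. -/
lemma integral_Iic_mul_integral_Ioi_le (w : ℝ) :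
    (∫ x in Set.Iic w, gaussKernel x) * ∫ x in Set.Ioi w, gaussKernel x ≤
      π / 2 * gaussKernel w := by
  wlog hw : 0 ≤ w generalizing w
  · have h := this (-w) (by linarith)
    rw [integral_Iic_gaussKernel, neg_neg, ← integral_Iic_gaussKernel, gaussKernel_neg,
      mul_comm] at h
    exact h
  have h1 := intervalIntegral.integral_Iic_sub_Iic
    (integrable_gaussKernel.integrableOn (s := Set.Iic 0))
    (integrable_gaussKernel.integrableOn (s := Set.Iic w))
  have h2 := integral_Iic_add_Ioi integrable_gaussKernel w
  have h3 := one_sub_gaussKernel_le_sq w hw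
  have h4 : ∫ x in Set.Iic 0, gaussKernel x = √(2 * π) / 2 := by
    rw [integral_Iic_gaussKernel, neg_zero, integral_Ioi_zero_gaussKernel]
  rw [integral_gaussKernel] at h2
  rw [h4] at h1
  have h5 : √(2 * π) ^ 2 = 2 * π := sq_sqrt (by positivity)
  rw [← h1] at h3
  have h6 : ∫ x in Set.Ioi w, gaussKernel x
      = √(2 * π) - ∫ x in Set.Iic w, gaussKernel x := by linarith
  rw [h6]
  nlinarith

lemma integral_gaussianReal_eq (h : ℝ → ℝ) :
    (∫ x, h x * gaussKernel x) = √(2 * π) * ∫ z, h z ∂(gaussianReal 0 1) := by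
  rw [integral_gaussianReal_eq_integral_smul one_ne_zero, ← integral_const_mul]
  congr 1 with x
  have hp : √(2 * π) ≠ 0 := by positivity
  simp only [gaussianPDFReal, gaussKernel, NNReal.coe_one, mul_one, sub_zero, smul_eq_mul]
  field_simp

lemma hasDerivAt_integral_Iic {g : ℝ → ℝ} (hg : Integrable g) (hc : Continuous g) (w : ℝ) :
    HasDerivAt (fun y => ∫ x in Set.Iic y, g x) (g w) w := by
  have h : (fun y => ∫ x in Set.Iic y, g x) =
      fun y => (∫ x in Set.Iic 0, g x) + ∫ x in (0 : ℝ)..y, g x := by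
    ext y
    rw [← intervalIntegral.integral_Iic_sub_Iic hg.integrableOn hg.integrableOn]
    ring
  rw [h]
  exact (hc.integral_hasStrictDerivAt 0 w).hasDerivAt.const_add _

lemma integrable_mul_gaussKernel {h : ℝ → ℝ} {M : ℝ} (hc : Continuous h) (hM : ∀ x, |h x| ≤ M) :
    Integrable (fun x => h x * gaussKernel x) :=
  integrable_gaussKernel.bdd_mul hc.aestronglyMeasurable (ae_of_all _ hM)

/-- The bounded solution of the Stein equation `f' - w f = h - E[h(Z)]`. -/
noncomputable def steinSol (h : ℝ → ℝ) (w : ℝ) : ℝ :=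
  exp (w ^ 2 / 2) * ∫ x in Set.Iic w, (h x - ∫ z, h z ∂(gaussianReal 0 1)) * gaussKernel x

/-- The derivative of `steinSol h`. -/
noncomputable def steinDeriv (h : ℝ → ℝ) (w : ℝ) : ℝ :=
  w * steinSol h w + (h w - ∫ z, h z ∂(gaussianReal 0 1))

section Bounded

variable {h : ℝ → ℝ} {M : ℝ}

lemma integrable_centered (hc : Continuous h) (hM : ∀ x, |h x| ≤ M) :
    Integrable (fun x => (h x - ∫ z, h z ∂(gaussianReal 0 1)) * gaussKernel x) := by
  simp only [sub_mul]
  exact (integrable_mul_gaussKernel hc hM).sub (integrable_gaussKernel.const_mul _)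

lemma integral_centered (hc : Continuous h) (hM : ∀ x, |h x| ≤ M) :
    ∫ x, (h x - ∫ z, h z ∂(gaussianReal 0 1)) * gaussKernel x = 0 := by
  simp only [sub_mul]
  rw [integral_sub (integrable_mul_gaussKernel hc hM) (integrable_gaussKernel.const_mul _),
    integral_const_mul, integral_gaussKernel, integral_gaussianReal_eq]
  ring

lemma hasDerivAt_steinSol (hc : Continuous h) (hM : ∀ x, |h x| ≤ M) (w : ℝ) :
    HasDerivAt (steinSol h) (steinDeriv h w) w := by
  have h1 : HasDerivAt (fun y : ℝ => exp (y ^ 2 / 2)) (exp (w ^ 2 / 2) * w) w := by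
    have := ((hasDerivAt_pow 2 w).div_const 2).exp
    convert! this using 2
    simp
  have h2 := h1.mul (hasDerivAt_integral_Iic (integrable_centered hc hM)
    (by have := continuous_gaussKernel; fun_prop) w)
  convert! h2 using 1
  simp only [steinDeriv, steinSol]
  linear_combination (-(h w - ∫ z, h z ∂(gaussianReal 0 1))) * exp_mul_gaussKernel w

lemma continuous_steinSol (hc : Continuous h) (hM : ∀ x, |h x| ≤ M) : Continuous (steinSol h) :=
  continuous_iff_continuousAt.2 fun w => (hasDerivAt_steinSol hc hM w).continuousAt

lemma continuous_steinDeriv (hc : Continuous h) (hM : ∀ x, |h x| ≤ M) :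
    Continuous (steinDeriv h) := by
  have := continuous_steinSol hc hM
  unfold steinDeriv
  fun_prop

lemma abs_setIntegral_mul_gaussKernel_le (hM : ∀ x, |h x| ≤ M) (s : Set ℝ) :
    |∫ x in s, h x * gaussKernel x| ≤ M * ∫ x in s, gaussKernel x := by
  rw [← integral_const_mul, ← Real.norm_eq_abs]
  refine norm_integral_le_of_norm_le (integrable_gaussKernel.const_mul M).integrableOn
    (ae_of_all _ fun x => ?_)
  rw [norm_mul, Real.norm_eq_abs, Real.norm_eq_abs, abs_of_pos (gaussKernel_pos x)]
  exact mul_le_mul_of_nonneg_right (hM x) (gaussKernel_pos x).le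

/-- The solution of the Stein equation in terms of the contributions of the two tails. -/
lemma sqrt_mul_integral_centered (hc : Continuous h) (hM : ∀ x, |h x| ≤ M) (w : ℝ) :
    √(2 * π) * ∫ x in Set.Iic w, (h x - ∫ z, h z ∂(gaussianReal 0 1)) * gaussKernel x =
      (∫ x in Set.Iic w, h x * gaussKernel x) * (∫ x in Set.Ioi w, gaussKernel x) -
      (∫ x in Set.Ioi w, h x * gaussKernel x) * ∫ x in Set.Iic w, gaussKernel x := by
  have hi := integrable_mul_gaussKernel hc hM
  have h1 := integral_Iic_add_Ioi hi w
  have h2 := integral_Iic_add_Ioi integrable_gaussKernel w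
  rw [integral_gaussianReal_eq] at h1
  rw [integral_gaussKernel] at h2
  simp only [sub_mul]
  rw [integral_sub hi.integrableOn (integrable_gaussKernel.const_mul _).integrableOn,
    integral_const_mul]
  linear_combination (∫ x in Set.Iic w, gaussKernel x) * h1 -
    (∫ x in Set.Iic w, h x * gaussKernel x) * h2

lemma abs_steinSol_le (hc : Continuous h) (hM : ∀ x, |h x| ≤ M) (w : ℝ) :
    |steinSol h w| ≤ √(π / 2) * M := by
  have hM0 : 0 ≤ M := (abs_nonneg _).trans (hM 0)
  have hp : 0 < √(2 * π) := by positivity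
  have hk := sqrt_mul_integral_centered hc hM w
  have h1 := abs_setIntegral_mul_gaussKernel_le hM (Set.Iic w)
  have h2 := abs_setIntegral_mul_gaussKernel_le hM (Set.Ioi w)
  have h3 := integral_Iic_mul_integral_Ioi_le w
  have ha : 0 ≤ ∫ x in Set.Iic w, gaussKernel x := integral_nonneg fun x => (gaussKernel_pos x).le
  have hb : 0 ≤ ∫ x in Set.Ioi w, gaussKernel x := integral_nonneg fun x => (gaussKernel_pos x).le
  rw [steinSol, abs_mul, abs_of_pos (exp_pos _)]
  generalize (∫ x in Set.Iic w, (h x - ∫ z, h z ∂(gaussianReal 0 1)) * gaussKernel x) = k at *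
  generalize (∫ x in Set.Iic w, h x * gaussKernel x) = p at *
  generalize (∫ x in Set.Ioi w, h x * gaussKernel x) = q at *
  generalize (∫ x in Set.Iic w, gaussKernel x) = a at *
  generalize (∫ x in Set.Ioi w, gaussKernel x) = b at *
  have hs : √(π / 2) * √(2 * π) = π := by
    rw [← sqrt_mul (by positivity), show π / 2 * (2 * π) = π ^ 2 by ring, sqrt_sq pi_pos.le]
  have h4 : √(2 * π) * |k| ≤ M * π * gaussKernel w := by
    calc √(2 * π) * |k| = |p * b - q * a| := by rw [← hk, abs_mul, abs_of_pos hp]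
      _ ≤ |p| * b + |q| * a := by
        refine (abs_sub _ _).trans ?_
        rw [abs_mul, abs_mul, abs_of_nonneg ha, abs_of_nonneg hb]
      _ ≤ M * a * b + M * b * a := by gcongr
      _ = 2 * M * (a * b) := by ring
      _ ≤ 2 * M * (π / 2 * gaussKernel w) := by gcongr
      _ = _ := by ring
  refine le_of_mul_le_mul_left ?_ hp
  calc √(2 * π) * (exp (w ^ 2 / 2) * |k|) = exp (w ^ 2 / 2) * (√(2 * π) * |k|) := by ring
    _ ≤ exp (w ^ 2 / 2) * (M * π * gaussKernel w) := by gcongr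
    _ = √(2 * π) * (√(π / 2) * M) := by
      linear_combination M * π * exp_mul_gaussKernel w - M * hs

lemma abs_steinDeriv_le (hc : Continuous h) (hM : ∀ x, |h x| ≤ M) (w : ℝ) :
    |steinDeriv h w| ≤ 2 * M := by
  have hp : 0 < √(2 * π) := by positivity
  have hk := sqrt_mul_integral_centered hc hM w
  have h1 := abs_setIntegral_mul_gaussKernel_le hM (Set.Iic w)
  have h2 := abs_setIntegral_mul_gaussKernel_le hM (Set.Ioi w)
  have hub := mul_integral_Ioi_gaussKernel_le w
  have hua := neg_mul_integral_Iic_gaussKernel_le w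
  have hN := integral_Iic_add_Ioi (integrable_mul_gaussKernel hc hM) w
  have hI := integral_Iic_add_Ioi integrable_gaussKernel w
  rw [integral_gaussianReal_eq] at hN
  rw [integral_gaussKernel] at hI
  have he := exp_mul_gaussKernel w
  have he0 := exp_pos (w ^ 2 / 2)
  have hw := hM w
  rw [steinDeriv, steinSol]
  generalize (∫ x in Set.Iic w, (h x - ∫ z, h z ∂(gaussianReal 0 1)) * gaussKernel x) = k at *
  generalize (∫ x in Set.Iic w, h x * gaussKernel x) = p at *
  generalize (∫ x in Set.Ioi w, h x * gaussKernel x) = q at *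
  generalize (∫ x in Set.Iic w, gaussKernel x) = a at *
  generalize (∫ x in Set.Ioi w, gaussKernel x) = b at *
  generalize (∫ z, h z ∂(gaussianReal 0 1)) = c at *
  generalize exp (w ^ 2 / 2) = e at *
  have hB : 0 ≤ 1 - w * (e * b) := by
    have := mul_le_mul_of_nonneg_left hub he0.le
    linarith
  have hA : 0 ≤ 1 + w * (e * a) := by
    have := mul_le_mul_of_nonneg_left hua he0.le
    linarith
  have heq : √(2 * π) * (w * (e * k) + (h w - c)) =
      √(2 * π) * h w - (p * (1 - w * (e * b)) + q * (1 + w * (e * a))) := by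
    linear_combination w * e * hk + hN
  refine le_of_mul_le_mul_left ?_ hp
  calc √(2 * π) * |w * (e * k) + (h w - c)|
      = |√(2 * π) * h w - (p * (1 - w * (e * b)) + q * (1 + w * (e * a)))| := by
        rw [← heq, abs_mul, abs_of_pos hp]
    _ ≤ √(2 * π) * |h w| + (|p| * (1 - w * (e * b)) + |q| * (1 + w * (e * a))) := by
        refine (abs_sub _ _).trans ?_
        rw [abs_mul, abs_of_pos hp]
        gcongr
        refine (abs_add_le _ _).trans ?_
        rw [abs_mul, abs_mul, abs_of_nonneg hA, abs_of_nonneg hB]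
    _ ≤ √(2 * π) * M + (M * a * (1 - w * (e * b)) + M * b * (1 + w * (e * a))) := by gcongr
    _ = √(2 * π) * (2 * M) := by linear_combination M * hI

/-- For a nondecreasing centered `H`, the Stein solution `f` satisfies `(w f)' ≤ 0`. -/
lemma one_add_sq_mul_integral_Iic_le {H : ℝ → ℝ} (hmono : Monotone H)
    (hint : Integrable (fun x => H x * gaussKernel x)) (h0 : ∫ x, H x * gaussKernel x = 0)
    (w : ℝ) :
    (1 + w ^ 2) * (exp (w ^ 2 / 2) * ∫ x in Set.Iic w, H x * gaussKernel x) + w * H w ≤ 0 := by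
  have he := exp_mul_gaussKernel w
  have he0 := exp_pos (w ^ 2 / 2)
  have hw : 0 < 1 + w ^ 2 := by positivity
  rcases le_total (H w) 0 with hH | hH
  · have h1 : ∫ x in Set.Iic w, H x * gaussKernel x ≤ H w * ∫ x in Set.Iic w, gaussKernel x := by
      rw [← integral_const_mul]
      refine setIntegral_mono_on hint.integrableOn
        (integrable_gaussKernel.const_mul _).integrableOn measurableSet_Iic fun x hx => ?_
      exact mul_le_mul_of_nonneg_right (hmono hx) (gaussKernel_pos x).le
    have h2 := neg_mul_gaussKernel_le_integral_Iic w
    have h3 := mul_le_mul_of_nonneg_left h1 (mul_pos hw he0).le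
    have h4 := mul_le_mul_of_nonpos_left (mul_le_mul_of_nonneg_left h2 he0.le) hH
    linear_combination h3 + h4 - w * H w * he
  · have h1 : H w * (∫ x in Set.Ioi w, gaussKernel x) ≤ ∫ x in Set.Ioi w, H x * gaussKernel x := by
      rw [← integral_const_mul]
      refine setIntegral_mono_on (integrable_gaussKernel.const_mul _).integrableOn
        hint.integrableOn measurableSet_Ioi fun x hx => ?_
      exact mul_le_mul_of_nonneg_right (hmono (le_of_lt hx)) (gaussKernel_pos x).le
    have h2 := mul_gaussKernel_le_integral_Ioi w
    have h3 := mul_le_mul_of_nonneg_left h1 (mul_pos hw he0).le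
    have h4 := mul_le_mul_of_nonneg_left (mul_le_mul_of_nonneg_left h2 he0.le) hH
    have h5 := integral_Iic_add_Ioi hint w
    rw [h0] at h5
    linear_combination h3 + h4 - w * H w * he + (1 + w ^ 2) * exp (w ^ 2 / 2) * h5

lemma mul_deriv_id_mul_steinSol_le {L : ℝ} (hc : Continuous h) (hM : ∀ x, |h x| ≤ M) (s : ℝ)
    (hmono : Monotone fun x => L * x + s * h x) (w : ℝ) :
    s * (steinSol h w + w * steinDeriv h w) ≤ L := by
  set c := ∫ z, h z ∂(gaussianReal 0 1) with hcdef
  have h1 := integrable_id_mul_gaussKernel.const_mul L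
  have h2 := (integrable_centered hc hM).const_mul s
  have heq : (fun x => (L * x + s * h x - s * c) * gaussKernel x) =
      fun x => L * (x * gaussKernel x) + s * ((h x - c) * gaussKernel x) := by
    ext x
    ring
  have hint : Integrable (fun x => (L * x + s * h x - s * c) * gaussKernel x) := by
    rw [heq]
    exact h1.add h2
  have h0 : ∫ x, (L * x + s * h x - s * c) * gaussKernel x = 0 := by
    rw [heq, integral_add h1 h2, integral_const_mul, integral_const_mul,
      integral_id_mul_gaussKernel, integral_centered hc hM]
    simp
  have hI : ∫ x in Set.Iic w, (L * x + s * h x - s * c) * gaussKernel x =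
      L * -gaussKernel w + s * ∫ x in Set.Iic w, (h x - c) * gaussKernel x := by
    rw [heq, integral_add h1.integrableOn h2.integrableOn, integral_const_mul,
      integral_const_mul, integral_Iic_id_mul_gaussKernel]
  have hmain := one_add_sq_mul_integral_Iic_le (H := fun x => L * x + s * h x - s * c)
    (fun x y hxy => sub_le_sub_right (hmono hxy) _) hint h0 w
  simp only [hI] at hmain
  rw [steinDeriv, steinSol, ← hcdef]
  linear_combination hmain + (1 + w ^ 2) * L * exp_mul_gaussKernel w

lemma abs_steinDeriv_sub_le {L : ℝ} (hc : Continuous h) (hM : ∀ x, |h x| ≤ M)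
    (hL : ∀ x y, |h x - h y| ≤ L * |x - y|) (x y : ℝ) :
    |steinDeriv h x - steinDeriv h y| ≤ 2 * L * |x - y| := by
  have hmono : ∀ s : ℝ, |s| = 1 → Monotone fun x => L * x + s * h x := fun s hs x y hxy => by
    have h1 : s * (h x - h y) ≤ L * (y - x) := by
      refine (le_abs_self _).trans ?_
      rw [abs_mul, hs, one_mul, ← abs_of_nonneg (sub_nonneg.2 hxy), abs_sub_comm y x]
      exact hL x y
    show L * x + s * h x ≤ L * y + s * h y
    linarith
  have hder : ∀ w, HasDerivAt (fun w => w * steinSol h w) (steinSol h w + w * steinDeriv h w) w :=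
    fun w => by simpa using! (hasDerivAt_id w).mul (hasDerivAt_steinSol hc hM w)
  have hbd : ∀ w, ‖steinSol h w + w * steinDeriv h w‖ ≤ L := fun w => by
    have h1 := mul_deriv_id_mul_steinSol_le hc hM 1 (hmono 1 (by simp)) w
    have h2 := mul_deriv_id_mul_steinSol_le hc hM (-1) (hmono (-1) (by simp)) w
    rw [Real.norm_eq_abs, abs_le]
    constructor <;> linarith
  have h3 := Convex.norm_image_sub_le_of_norm_hasDerivWithin_le (x := y) (y := x)
    (fun w _ => (hder w).hasDerivWithinAt) (fun w _ => hbd w) convex_univ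
    (Set.mem_univ _) (Set.mem_univ _)
  simp only [Real.norm_eq_abs] at h3
  calc |steinDeriv h x - steinDeriv h y|
      = |(x * steinSol h x - y * steinSol h y) + (h x - h y)| := by
        simp only [steinDeriv]
        congr 1
        ring
    _ ≤ |x * steinSol h x - y * steinSol h y| + |h x - h y| := abs_add_le _ _
    _ ≤ L * |x - y| + L * |x - y| := add_le_add h3 (hL x y)
    _ = _ := by ring

end Bounded

/-- First-order Taylor estimate for a function with Lipschitz derivative. -/
lemma abs_sub_sub_mul_le_of_lipschitz_deriv {f f' : ℝ → ℝ} {L : ℝ}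
    (hf : ∀ x, HasDerivAt f (f' x) x) (hL : ∀ x y, |f' x - f' y| ≤ 2 * L * |x - y|) (w d : ℝ) :
    |f w - f (w - d) - d * f' w| ≤ L * d ^ 2 := by
  have hu : ∀ t : ℝ, HasDerivAt (fun t => f w - f (w - t * d) - t * d * f' w)
      (d * (f' (w - t * d) - f' w)) t := fun t => by
    have h1 : HasDerivAt (fun t : ℝ => t * d) d t := by
      simpa using (hasDerivAt_id t).mul_const d
    have h2 := (((hf (w - t * d)).comp t (h1.const_sub w)).const_sub (f w)).sub
      (h1.mul_const (f' w))
    convert! h2 using 1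
    ring
  have hB : ∀ t : ℝ, HasDerivAt (fun t => L * d ^ 2 * t ^ 2) (2 * L * d ^ 2 * t) t := fun t => by
    convert! (hasDerivAt_pow 2 t).const_mul (L * d ^ 2) using 1
    push_cast
    ring
  have h := image_norm_le_of_norm_deriv_right_le_deriv_boundary (a := 0) (b := 1)
    (fun t _ => (hu t).continuousAt.continuousWithinAt) (fun t _ => (hu t).hasDerivWithinAt)
    (by simp) hB (fun t ht => ?_) (Set.right_mem_Icc.2 zero_le_one)
  · simpa using h
  · rw [norm_mul, Real.norm_eq_abs, Real.norm_eq_abs]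
    refine (mul_le_mul_of_nonneg_left (hL _ _) (abs_nonneg d)).trans (le_of_eq ?_)
    rw [sub_sub_cancel_left, abs_neg, abs_mul, abs_of_nonneg ht.1, ← sq_abs d]
    ring

/-- A continuous function with bounded derivative off a finite set is Lipschitz. -/
lemma abs_sub_le_of_piecewiseC1 {h : ℝ → ℝ} {L : ℝ} (hc : Continuous h) (hp : PiecewiseC1 h)
    (hL : ∀ x, |deriv h x| ≤ L) (x y : ℝ) : |h x - h y| ≤ L * |x - y| := by
  obtain ⟨S, hS⟩ := hp
  have hint : IntervalIntegrable (deriv h) volume y x := by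
    refine (intervalIntegrable_const (c := L)).mono_fun'
      (measurable_deriv h).aestronglyMeasurable (ae_of_all _ hL)
  rw [← integral_eq_of_hasDerivAt_off_countable h (deriv h) S.countable_toSet hc.continuousOn
    (fun z hz => (hS z hz.2).1.hasDerivAt) hint, ← Real.norm_eq_abs]
  exact intervalIntegral.norm_integral_le_of_norm_le_const fun z _ => hL z

section Probability

variable {Ω : Type*} {m0 : MeasurableSpace Ω} {μ : Measure Ω} [IsProbabilityMeasure μ]

lemma abs_integral_mul_le_of_condExp {m : MeasurableSpace Ω} (hm : m ≤ m0) {Y g : Ω → ℝ} {C : ℝ}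
    (hY : Integrable Y μ) (hg : Measurable[m] g) (hC : ∀ ω, |g ω| ≤ C) :
    |∫ ω, Y ω * g ω ∂μ| ≤ C * ∫ ω, |(μ[Y | m]) ω| ∂μ := by
  have hYg : Integrable (Y * g) μ :=
    hY.mul_bdd (hg.mono hm le_rfl).aestronglyMeasurable (ae_of_all _ hC)
  have h1 := condExp_mul_of_stronglyMeasurable_right (m := m) hg.stronglyMeasurable hYg hY
  have h2 : ∫ ω, Y ω * g ω ∂μ = ∫ ω, (μ[Y | m]) ω * g ω ∂μ := by
    exact (integral_condExp hm).symm.trans (integral_congr_ae h1)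
  rw [h2, ← integral_const_mul, ← Real.norm_eq_abs]
  refine norm_integral_le_of_norm_le (integrable_condExp.abs.const_mul C) (ae_of_all _ fun ω => ?_)
  rw [norm_mul, mul_comm]
  exact mul_le_mul_of_nonneg_right (hC ω) (abs_nonneg _)

lemma integral_abs_le_sqrt_integral_sq {T : Ω → ℝ} (hT : Integrable T μ)
    (hT2 : Integrable (fun ω => T ω ^ 2) μ) : ∫ ω, |T ω| ∂μ ≤ √(∫ ω, T ω ^ 2 ∂μ) := by
  refine le_sqrt_of_sq_le ?_
  have h := ConvexOn.map_integral_le (μ := μ) (f := fun ω => |T ω|) (g := fun x : ℝ => x ^ 2)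
    even_two.convexOn_pow (by fun_prop) isClosed_univ (by simp) hT.abs
    (by simpa [Function.comp_def] using hT2)
  simpa using h

end Probability

end SteinNormal

/-- **Univariate normal approximation under local dependence** (Stein; Goldstein–Rinott,
Theorem 1.3). `X 1, …, X n` are centered random variables, `S v ⊆ {1,…,n}` are
"dependency neighborhoods", `W = ∑ v, X v` and `σ² = ∑_v ∑_{u ∈ S v} E[X_v X_u] > 0`.
The σ-field in the middle term is the one generated by `{X u : u ∉ S v}`. -/
theorem stein_local_dependence_univariate
    {n : ℕ} {Ω : Type*} [MeasurableSpace Ω] {μ : Measure Ω} [IsProbabilityMeasure μ]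
    (X : Fin n → Ω → ℝ) (hXmeas : ∀ v, Measurable (X v))
    (hXint : ∀ v, Integrable (X v) μ) (hXmean : ∀ v, ∫ ω, X v ω ∂μ = 0)
    (S : Fin n → Finset (Fin n))
    (hprodint : ∀ v u, Integrable (fun ω => X v ω * X u ω) μ)
    (σ : ℝ) (hσpos : 0 < σ)
    (hσ : σ ^ 2 = ∑ v, ∑ u ∈ S v, ∫ ω, X v ω * X u ω ∂μ)
    (hsqint : Integrable (fun ω =>
      (∑ v, ∑ u ∈ S v, (X v ω * X u ω - ∫ ω', X v ω' * X u ω' ∂μ)) ^ 2) μ)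
    (htripleint : ∀ v, Integrable
      (fun ω => |X v ω * (∑ u ∈ S v, X u ω) * (∑ t ∈ S v, X t ω)|) μ)
    (h : ℝ → ℝ) (hhmeas : Measurable h) (hhcont : Continuous h)
    (hhbdd : ∃ C, ∀ x, |h x| ≤ C) (hpc1 : PiecewiseC1 h)
    (hh'bdd : ∃ C, ∀ x, |deriv h x| ≤ C) :
    |(∫ ω, h ((∑ v, X v ω) / σ) ∂μ) - ∫ z, h z ∂(gaussianReal 0 1)| ≤
      (2 * (⨆ x, |h x|) / σ ^ 2) *
        Real.sqrt (∫ ω,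
          (∑ v, ∑ u ∈ S v, (X v ω * X u ω - ∫ ω', X v ω' * X u ω' ∂μ)) ^ 2 ∂μ)
      + Real.sqrt (Real.pi / 2) * ((⨆ x, |h x|) / σ) *
        ∑ v, ∫ ω, |(μ[X v | ⨆ u ∈ ({u | u ∉ S v} : Set (Fin n)),
            MeasurableSpace.comap (X u) (borel ℝ)]) ω| ∂μ
      + ((⨆ x, |deriv h x|) / σ ^ 3) *
        ∑ v, ∫ ω, |X v ω * (∑ u ∈ S v, X u ω) * (∑ t ∈ S v, X t ω)| ∂μ := by
  have hMb : BddAbove (Set.range fun x => |h x|) := by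
    obtain ⟨C, hC⟩ := hhbdd
    exact ⟨C, by rintro _ ⟨x, rfl⟩; exact hC x⟩
  have hLb : BddAbove (Set.range fun x => |deriv h x|) := by
    obtain ⟨C, hC⟩ := hh'bdd
    exact ⟨C, by rintro _ ⟨x, rfl⟩; exact hC x⟩
  have hM : ∀ x, |h x| ≤ ⨆ x, |h x| := le_ciSup hMb
  have hL' : ∀ x, |deriv h x| ≤ ⨆ x, |deriv h x| := le_ciSup hLb
  generalize (⨆ x, |h x|) = M at *
  generalize (⨆ x, |deriv h x|) = L at *
  have hLip := SteinNormal.abs_sub_le_of_piecewiseC1 hhcont hpc1 hL'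
  have hf := SteinNormal.hasDerivAt_steinSol hhcont hM
  have hfc := SteinNormal.continuous_steinSol hhcont hM
  have hf'c := SteinNormal.continuous_steinDeriv hhcont hM
  have hfb := SteinNormal.abs_steinSol_le hhcont hM
  have hf'b := SteinNormal.abs_steinDeriv_le hhcont hM
  have hf'L := SteinNormal.abs_steinDeriv_sub_le hhcont hM hLip
  have hTaylor := SteinNormal.abs_sub_sub_mul_le_of_lipschitz_deriv hf hf'L
  have hstein : ∀ w, h w - ∫ z, h z ∂(gaussianReal 0 1) =
      SteinNormal.steinDeriv h w - w * SteinNormal.steinSol h w := fun w => by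
    rw [SteinNormal.steinDeriv]
    ring
  generalize SteinNormal.steinSol h = f at *
  generalize SteinNormal.steinDeriv h = f' at *
  generalize (∫ z, h z ∂(gaussianReal 0 1)) = c at *
  let W : Ω → ℝ := fun ω => (∑ v, X v ω) / σ
  let Y : Fin n → Ω → ℝ := fun v ω => ∑ u ∈ S v, X u ω
  let T : Ω → ℝ := fun ω => ∑ v, ∑ u ∈ S v, (X v ω * X u ω - ∫ ω', X v ω' * X u ω' ∂μ)
  let R : Fin n → Ω → ℝ := fun v ω => f (W ω) - f (W ω - Y v ω / σ) - Y v ω / σ * f' (W ω)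
  have hWm : Measurable W := by fun_prop
  have hYm : ∀ v, Measurable (Y v) := fun v => by fun_prop
  have hRm : ∀ v, Measurable (R v) := fun v => by
    have := hYm v
    have := hfc.measurable
    have := hf'c.measurable
    fun_prop
  have hTint : Integrable T μ := integrable_finsetSum _ fun v _ => integrable_finsetSum _ fun u _ =>
    (hprodint v u).sub (integrable_const _)
  have hTf' : Integrable (fun ω => T ω * f' (W ω)) μ :=
    hTint.mul_bdd (hf'c.measurable.comp hWm).aestronglyMeasurable (ae_of_all _ fun ω => hf'b (W ω))
  have hXf : ∀ v, Integrable (fun ω => X v ω * f (W ω - Y v ω / σ)) μ := fun v =>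
    (hXint v).mul_bdd
      (hfc.measurable.comp (hWm.sub ((hYm v).div_const σ))).aestronglyMeasurable
      (ae_of_all _ fun ω => hfb _)
  have hXRb : ∀ v ω, ‖X v ω * R v ω‖ ≤ L / σ ^ 2 * |X v ω * Y v ω * Y v ω| := fun v ω => by
    rw [norm_mul, Real.norm_eq_abs, Real.norm_eq_abs]
    refine (mul_le_mul_of_nonneg_left (hTaylor (W ω) (Y v ω / σ)) (abs_nonneg _)).trans
      (le_of_eq ?_)
    rw [abs_mul, abs_mul, mul_assoc |X v ω|, abs_mul_abs_self, div_pow]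
    ring
  have hXR : ∀ v, Integrable (fun ω => X v ω * R v ω) μ := fun v =>
    ((htripleint v).const_mul (L / σ ^ 2)).mono' ((hXmeas v).mul (hRm v)).aestronglyMeasurable
      (ae_of_all _ (hXRb v))
  have hTY : ∀ ω, ∑ v, X v ω * Y v ω = T ω + σ ^ 2 := fun ω => by
    simp only [T, Y, Finset.sum_sub_distrib, ← hσ, sub_add_cancel, Finset.mul_sum]
  have hpt : ∀ ω, h (W ω) - c = -(1 / σ ^ 2) * (T ω * f' (W ω)) -
      (1 / σ) * (∑ v, X v ω * f (W ω - Y v ω / σ)) - (1 / σ) * ∑ v, X v ω * R v ω := fun ω => by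
    have h1 : ∑ v, X v ω * R v ω = (∑ v, X v ω) * f (W ω) -
        (∑ v, X v ω * f (W ω - Y v ω / σ)) - (∑ v, X v ω * Y v ω) * (f' (W ω) / σ) := by
      rw [Finset.sum_mul, Finset.sum_mul, ← Finset.sum_sub_distrib, ← Finset.sum_sub_distrib]
      refine Finset.sum_congr rfl fun v _ => ?_
      simp only [R]
      ring
    have h2 : ∑ v, X v ω = σ * W ω := by
      simp only [W]
      field_simp
    rw [hstein, h1, hTY, h2]
    field_simp
    ring
  have hhW : Integrable (fun ω => h (W ω)) μ :=
    Integrable.of_bound (hhmeas.comp hWm).aestronglyMeasurable M (ae_of_all _ fun ω => hM (W ω))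
  have hint : (∫ ω, h (W ω) ∂μ) - c = -(1 / σ ^ 2) * (∫ ω, T ω * f' (W ω) ∂μ) -
      (1 / σ) * (∑ v, ∫ ω, X v ω * f (W ω - Y v ω / σ) ∂μ) -
      (1 / σ) * ∑ v, ∫ ω, X v ω * R v ω ∂μ := by
    have h1 := integrable_finsetSum Finset.univ fun v _ => hXf v
    have h2 := integrable_finsetSum Finset.univ fun v _ => hXR v
    have h3 : ∫ ω, (h (W ω) - c) ∂μ = (∫ ω, h (W ω) ∂μ) - c := by
      rw [integral_sub hhW (integrable_const _)]
      simp
    have h4 : Integrable (fun ω => -(1 / σ ^ 2) * (T ω * f' (W ω)) -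
        (1 / σ) * ∑ v, X v ω * f (W ω - Y v ω / σ)) μ := (hTf'.const_mul _).sub (h1.const_mul _)
    rw [← h3, ← integral_finsetSum _ fun v _ => hXf v, ← integral_finsetSum _ fun v _ => hXR v,
      ← integral_const_mul, ← integral_const_mul, ← integral_const_mul,
      ← integral_sub (hTf'.const_mul _) (h1.const_mul _),
      ← integral_sub h4 (h2.const_mul _)]
    exact integral_congr_ae (ae_of_all _ hpt)
  have hM0 : 0 ≤ M := (abs_nonneg _).trans (hM 0)
  have hbT : |∫ ω, T ω * f' (W ω) ∂μ| ≤ 2 * M * √(∫ ω, T ω ^ 2 ∂μ) := by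
    refine le_trans ?_ (mul_le_mul_of_nonneg_left
      (SteinNormal.integral_abs_le_sqrt_integral_sq hTint hsqint) (by positivity))
    rw [← integral_const_mul, ← Real.norm_eq_abs]
    refine norm_integral_le_of_norm_le (hTint.abs.const_mul _) (ae_of_all _ fun ω => ?_)
    rw [norm_mul, mul_comm]
    exact mul_le_mul_of_nonneg_right (hf'b _) (abs_nonneg _)
  have hbX : ∀ v, |∫ ω, X v ω * f (W ω - Y v ω / σ) ∂μ| ≤ √(π / 2) * M *
      ∫ ω, |(μ[X v | ⨆ u ∈ ({u | u ∉ S v} : Set (Fin n)),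
        MeasurableSpace.comap (X u) (borel ℝ)]) ω| ∂μ := fun v => by
    refine SteinNormal.abs_integral_mul_le_of_condExp ?_ (hXint v) ?_ fun ω => hfb _
    · refine iSup₂_le fun u _ => ?_
      rw [← BorelSpace.measurable_eq (α := ℝ)]
      exact (hXmeas u).comap_le
    · refine hfc.measurable.comp ?_
      have hWY : (fun ω => W ω - Y v ω / σ) = fun ω => (∑ u ∈ (S v)ᶜ, X u ω) / σ := by
        ext ω
        simp only [W, Y]
        rw [← Finset.sum_add_sum_compl (S v)]
        ring
      rw [hWY]
      refine Measurable.div_const (Finset.measurable_fun_sum _ fun u hu => ?_) σ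
      refine Measurable.mono (comap_measurable (X u)) ?_ le_rfl
      rw [← BorelSpace.measurable_eq (α := ℝ)]
      exact le_iSup₂_of_le u (by simpa using hu) le_rfl
  have hbR : ∀ v, |∫ ω, X v ω * R v ω ∂μ| ≤ L / σ ^ 2 * ∫ ω, |X v ω * Y v ω * Y v ω| ∂μ :=
    fun v => by
    rw [← integral_const_mul, ← Real.norm_eq_abs]
    exact norm_integral_le_of_norm_le ((htripleint v).const_mul _) (ae_of_all _ (hXRb v))
  have hsX := (Finset.abs_sum_le_sum_abs (fun v => ∫ ω, X v ω * f (W ω - Y v ω / σ) ∂μ)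
    Finset.univ).trans (Finset.sum_le_sum fun v _ => hbX v)
  have hsR := (Finset.abs_sum_le_sum_abs (fun v => ∫ ω, X v ω * R v ω ∂μ)
    Finset.univ).trans (Finset.sum_le_sum fun v _ => hbR v)
  rw [← Finset.mul_sum] at hsX hsR
  change |(∫ ω, h (W ω) ∂μ) - c| ≤ 2 * M / σ ^ 2 * √(∫ ω, T ω ^ 2 ∂μ) + _ +
    L / σ ^ 3 * ∑ v, ∫ ω, |X v ω * Y v ω * Y v ω| ∂μ
  rw [hint]
  refine (abs_sub _ _).trans (add_le_add ((abs_sub _ _).trans (add_le_add ?_ ?_)) ?_)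
  · rw [abs_mul, abs_neg, abs_of_pos (by positivity)]
    refine (mul_le_mul_of_nonneg_left hbT (by positivity)).trans (le_of_eq (by ring))
  · rw [abs_mul, abs_of_pos (by positivity)]
    refine (mul_le_mul_of_nonneg_left hsX (by positivity)).trans (le_of_eq (by ring))
  · rw [abs_mul, abs_of_pos (by positivity)]
    refine (mul_le_mul_of_nonneg_left hsR (by positivity)).trans (le_of_eq ?_)
    field_simp
end

section
/- Let U = (U₁,…,U_n) be a random vector in ℝⁿ and let ψ₁,…,ψ_n : ℝ → [0,∞) be measurable with 0 < E[ψ_i(U_i)] < ∞ for each i. For each i let Y^{(i)} = (Y₁^{(i)},…,Y_n^{(i)}) be a random vector whose law is absolutely continuous with respect to the law of U with density y ↦ ψ_i(y_i)/E[ψ_i(U_i)]. Let I be a random index taking values in {1,…,n}, independent of all the above, with P(I = i) = E[ψ_i(U_i)] / Σ_{j=1}^n E[ψ_j(U_j)]. Set W = Σ_{j=1}^n ψ_j(U_j), with law F and mean λ = E[W]. Then W* := Σ_{j=1}^n ψ_j(Y_j^{(I)}) has law w dF(w)/λ, i.e., W* has the W-size-biased distribution. -/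
open MeasureTheory ProbabilityTheory Real
open scoped ENNReal

/-- The law of a randomly selected variable `Z (I ω) ω`, for an index `I` independent of each
`Z i`, is the mixture of the laws of the `Z i`. -/
theorem map_random_index_eq_sum {Ω ι E : Type*} [MeasurableSpace Ω] [MeasurableSpace E]
    [Fintype ι] [MeasurableSpace ι] [MeasurableSingletonClass ι] {μ : Measure Ω}
    {I : Ω → ι} {Z : ι → Ω → E} (hI : Measurable I) (hZ : ∀ i, Measurable (Z i))
    (hindep : ∀ i, IndepFun I (Z i) μ) :
    μ.map (fun ω => Z (I ω) ω) = ∑ i, μ (I ⁻¹' {i}) • μ.map (Z i) := by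
  have hZI : Measurable fun ω => Z (I ω) ω :=
    (measurable_from_prod_countable_right (f := fun p : ι × Ω => Z p.1 p.2) hZ).comp
      (hI.prodMk measurable_id)
  ext A hA
  have hunion : (fun ω => Z (I ω) ω) ⁻¹' A = ⋃ i, I ⁻¹' {i} ∩ Z i ⁻¹' A := by
    ext ω
    simp
  have hdisj : Pairwise (Function.onFun Disjoint fun i => I ⁻¹' {i} ∩ Z i ⁻¹' A) :=
    fun i j hij => Set.disjoint_left.2 fun ω hi hj => hij (hi.1.symm.trans hj.1)
  rw [Measure.map_apply hZI hA, hunion, measure_iUnion hdisj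
    fun i => (hI (measurableSet_singleton i)).inter (hZ i hA), tsum_fintype,
    Measure.finsetSum_apply]
  refine Finset.sum_congr rfl fun i _ => ?_
  rw [(hindep i).measure_inter_preimage_eq_mul _ _ (measurableSet_singleton i) hA,
    Measure.smul_apply, Measure.map_apply (hZ i) hA, smul_eq_mul]

/-- **Size biasing a sum of nonnegative functions** (Dembo–Rinott; Goldstein–Rinott,
Lemma 2.2). `U = (U₁,…,Uₙ)` is a random vector, `ψ i : ℝ → [0,∞)` with
`0 < m i = E[ψ i (U i)] < ∞`.  For each `i`, `Y i` is a random vector whose law is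
absolutely continuous with respect to the law of `U` with density
`y ↦ ψ i (y i)/m i`, and `I` is a random index, independent of `U` and the `Y i`'s,
with `P(I = i) = m i / λ`, `λ = ∑ j, m j = E[W]` for `W = ∑ j, ψ j (U j)`. Then
`W* = ∑ j, ψ j (Y (I) j)` has the `W`-size biased law `w dF(w)/λ`, `F` the law of `W`. -/
theorem size_bias_sum_of_functions
    {n : ℕ} {Ω : Type*} [MeasurableSpace Ω] {μ : Measure Ω} [IsProbabilityMeasure μ]
    (U : Ω → Fin n → ℝ) (hUmeas : Measurable U)
    (ψ : Fin n → ℝ → ℝ) (hψmeas : ∀ i, Measurable (ψ i)) (hψnn : ∀ i u, 0 ≤ ψ i u)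
    (hψint : ∀ i, Integrable (fun ω => ψ i (U ω i)) μ)
    (m : Fin n → ℝ) (hm : ∀ i, m i = ∫ ω, ψ i (U ω i) ∂μ) (hmpos : ∀ i, 0 < m i)
    (lam : ℝ) (hlam : lam = ∑ j, m j)
    (Y : Fin n → Ω → Fin n → ℝ) (hYmeas : ∀ i, Measurable (Y i))
    (hYlaw : ∀ i, Measure.map (Y i) μ =
      (Measure.map U μ).withDensity fun y => ENNReal.ofReal (ψ i (y i) / m i))
    (I : Ω → Fin n) (hImeas : Measurable I)
    (hIlaw : ∀ i, μ (I ⁻¹' {i}) = ENNReal.ofReal (m i / lam))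
    (hindep : IndepFun I (fun ω => (U ω, fun i => Y i ω)) μ) :
    Measure.map (fun ω => ∑ j, ψ j (Y (I ω) ω j)) μ =
      (Measure.map (fun ω => ∑ j, ψ j (U ω j)) μ).withDensity
        (fun w => ENNReal.ofReal (w / lam)) := by
  have hg : Measurable fun y : Fin n → ℝ => ∑ j, ψ j (y j) :=
    Finset.measurable_sum _ fun j _ => (hψmeas j).comp (measurable_pi_apply j)
  have hdens : ∀ i, Measurable fun y : Fin n → ℝ => ENNReal.ofReal (ψ i (y i) / m i) :=
    fun i => (((hψmeas i).comp (measurable_pi_apply i)).div_const _).ennreal_ofReal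
  have hlam0 : 0 ≤ lam := hlam ▸ Finset.sum_nonneg fun i _ => (hmpos i).le
  have hind : ∀ i, IndepFun I (fun ω => ∑ j, ψ j (Y i ω j)) μ := fun i =>
    hindep.comp measurable_id (hg.comp ((measurable_pi_apply i).comp measurable_snd))
  rw [map_random_index_eq_sum (Z := fun i ω => ∑ j, ψ j (Y i ω j)) hImeas
    (fun i => hg.comp (hYmeas i)) hind]
  ext A hA
  have hW : μ.map (fun ω => ∑ j, ψ j (U ω j)) =
      (μ.map U).map fun y => ∑ j, ψ j (y j) := (Measure.map_map hg hUmeas).symm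
  rw [withDensity_apply _ hA, hW,
    setLIntegral_map hA (by fun_prop) hg, Measure.finsetSum_apply]
  have hterm : ∀ i, (μ (I ⁻¹' {i}) • μ.map fun ω => ∑ j, ψ j (Y i ω j)) A =
      ∫⁻ y in (fun y : Fin n → ℝ => ∑ j, ψ j (y j)) ⁻¹' A,
        ENNReal.ofReal (m i / lam) * ENNReal.ofReal (ψ i (y i) / m i) ∂μ.map U := by
    intro i
    rw [lintegral_const_mul _ (hdens i), ← withDensity_apply _ (hg hA), ← hYlaw i,
      Measure.smul_apply, hIlaw i, smul_eq_mul, ← Measure.map_apply hg hA,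
      Measure.map_map hg (hYmeas i)]
    rfl
  simp_rw [hterm]
  rw [← lintegral_finsetSum _ fun i _ => (hdens i).const_mul _]
  refine lintegral_congr fun y => ?_
  rw [Finset.sum_div, ENNReal.ofReal_sum_of_nonneg fun i _ => div_nonneg (hψnn i _) hlam0]
  refine Finset.sum_congr rfl fun i _ => ?_
  rw [← ENNReal.ofReal_mul (div_nonneg (hmpos i).le hlam0), mul_comm,
    div_mul_div_cancel₀ (hmpos i).ne']
end
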